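/- Let (U,S) be an instance of Exact 3-Set Cover with |U|=3k, |S|=m and 1 ≤ k ≤ m, and let M be the multilayer network constructed from it as described, with evader v̂, contacts F = U ∪ W, closeness centrality, and safety margin d = 1. Then S contains k pairwise disjoint sets whose union is U if and only if this instance of Multilayer Global Hiding has a solution, i.e., there is an admissible edge set A* joining v̂ to every contact in at least one layer such that in the resulting network at least one node has global closeness centrality strictly greater than that of v̂. -/

import Mathlib

open scoped Classical ENNReal

/-- A multilayer network: `occ v α` means node `v` occurs in layer `α`;
`Edge` is the edge relation on occurrences. -/
structure MLNet (V : Type*) (L : Type*) where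
  occ : V → L → Prop
  Edge : V × L → V × L → Prop

namespace MLNet

variable {V : Type*} {L : Type*}

/-- The axioms of a multilayer network with diagonal couplings: the edge relation is
symmetric, has no self-loops, joins only occurrences, and inter-layer edges join
two occurrences of the same node. -/
def IsValid (M : MLNet V L) : Prop :=
  (∀ a b, M.Edge a b → M.Edge b a) ∧
  (∀ a, ¬ M.Edge a a) ∧
  (∀ a b, M.Edge a b → M.occ a.1 a.2 ∧ M.occ b.1 b.2) ∧
  (∀ a b, M.Edge a b → a.2 ≠ b.2 → a.1 = b.1)

/-- The simple graph on occurrences given by the (symmetrized) edge relation. -/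
def flat (M : MLNet V L) : SimpleGraph (V × L) := SimpleGraph.fromRel M.Edge

/-- Global degree centrality: the number of nodes `w ≠ v` such that some edge joins an
occurrence of `v` and an occurrence of `w`. -/
noncomputable def degGlobal (M : MLNet V L) (v : V) : ℕ :=
  {w : V | w ≠ v ∧ ∃ α β, M.Edge (v, α) (w, β) ∨ M.Edge (w, β) (v, α)}.ncard

/-- Multilayer distance: the least length of a path from an occurrence of `v` to an
occurrence of `w` (`⊤` if there is none). -/
noncomputable def mdist (M : MLNet V L) (v w : V) : ℕ∞ :=
  ⨅ (α : L) (β : L) (_ : M.occ v α) (_ : M.occ w β), M.flat.edist (v, α) (w, β)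

/-- Global closeness centrality, valued in `ℝ≥0∞` (so that `1/∞ = 0`). -/
noncomputable def closGlobal (M : MLNet V L) [Fintype V] (v : V) : ℝ≥0∞ :=
  ∑ w ∈ Finset.univ.filter (fun w => w ≠ v), ((M.mdist v w : ℝ≥0∞))⁻¹

variable [Fintype V] [Fintype L]

/-- The number of shortest multilayer paths between nodes `w` and `u`
(`0` if they are not connected). -/
noncomputable def numSP (M : MLNet V L) (w u : V) : ℕ :=
  ∑ α : L, ∑ β : L,
    if M.occ w α ∧ M.occ u β then
      (M.flat.finsetWalkLength (M.mdist w u).toNat (w, α) (u, β)).card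
    else 0

/-- The number of pairs `(v^γ, p)` where `p` is a shortest multilayer path between `w` and `u`
passing through the occurrence `v^γ`. -/
noncomputable def numSPthrough (M : MLNet V L) (v w u : V) : ℕ :=
  ∑ α : L, ∑ β : L,
    if M.occ w α ∧ M.occ u β then
      ∑ p ∈ M.flat.finsetWalkLength (M.mdist w u).toNat (w, α) (u, β),
        (Finset.univ.filter (fun γ : L => (v, γ) ∈ p.support)).card
    else 0

/-- Global betweenness centrality: the sum over unordered pairs `{w,u}` of connected nodes
(distinct from `v`) of the fraction of shortest multilayer paths passing through an
occurrence of `v` (division by zero, for unconnected pairs, gives `0`). -/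
noncomputable def betwGlobal (M : MLNet V L) (v : V) : ℝ :=
  (1 / 2) * ∑ w : V, ∑ u : V,
    if w ≠ v ∧ u ≠ v ∧ w ≠ u then (M.numSPthrough v w u : ℝ) / (M.numSP w u : ℝ) else 0

/-- The simple graph `G^α` of a single layer (nodes not occurring in `α` are isolated). -/
def layerGraph (M : MLNet V L) (α : L) : SimpleGraph V :=
  SimpleGraph.fromRel (fun v w => M.Edge (v, α) (w, α))

/-- Degree of a node in the graph of layer `α`. -/
noncomputable def layerDeg (M : MLNet V L) (α : L) (v : V) : ℕ :=
  ((M.layerGraph α).neighborSet v).ncard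

end MLNet

/-- `Admissible M ve F A`: `A` encodes a set of intra-layer edges joining the evader `ve`
to contacts; `(v, α) ∈ A` encodes the edge `(ve^α, v^α)`, which requires `v ∈ F` and
both `ve` and `v` to occur in layer `α`. -/
def Admissible {V L : Type*} (M : MLNet V L) (ve : V) (F : Set V) (A : Set (V × L)) : Prop :=
  ∀ p ∈ A, p.1 ∈ F ∧ M.occ ve p.2 ∧ M.occ p.1 p.2

/-- The network obtained from `M` by adding, for each `(v, α) ∈ A`, the edge `(ve^α, v^α)`. -/
def MLNet.addEdges {V L : Type*} (M : MLNet V L) (ve : V) (A : Set (V × L)) : MLNet V L where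
  occ := M.occ
  Edge a b := M.Edge a b ∨
    ∃ p ∈ A, (a = (ve, p.2) ∧ b = (p.1, p.2)) ∨ (b = (ve, p.2) ∧ a = (p.1, p.2))

/-- `A` joins the evader to every contact in at least one layer. -/
def ConnectsAll {V L : Type*} (F : Set V) (A : Set (V × L)) : Prop :=
  ∀ v ∈ F, ∃ α, (v, α) ∈ A

section SG

variable {V : Type*} [Fintype V]

/-- Closeness centrality in a simple graph, valued in `ℝ≥0∞` (so that `1/∞ = 0`). -/
noncomputable def closSG (G : SimpleGraph V) (v : V) : ℝ≥0∞ :=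
  ∑ w ∈ Finset.univ.filter (fun w => w ≠ v), ((G.edist v w : ℝ≥0∞))⁻¹

/-- The number of shortest paths between `w` and `u` in a simple graph
(`0` if they are not connected and distinct). -/
noncomputable def numSPsg (G : SimpleGraph V) (w u : V) : ℕ :=
  (G.finsetWalkLength (G.edist w u).toNat w u).card

/-- The number of shortest paths between `w` and `u` passing through `v`. -/
noncomputable def numSPsgThrough (G : SimpleGraph V) (v w u : V) : ℕ :=
  ((G.finsetWalkLength (G.edist w u).toNat w u).filter (fun p => v ∈ p.support)).card

/-- Betweenness centrality in a simple graph: the sum over unordered pairs `{w,u}` of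
connected vertices distinct from `v` of the fraction of shortest paths through `v`. -/
noncomputable def betwSG (G : SimpleGraph V) (v : V) : ℝ :=
  (1 / 2) * ∑ w : V, ∑ u : V,
    if w ≠ v ∧ u ≠ v ∧ w ≠ u then (numSPsgThrough G v w u : ℝ) / (numSPsg G w u : ℝ) else 0

end SG

namespace XC

/-- Nodes of the gadget: the universe `U`, nodes `W = {w_{i,1},w_{i,2},w_{i,3}}`,
`A = {a₁,…,a_m}`, `B = {b₁,…,b_{2k+2m}}`, `B' = {b'₁,…,b'_{k+2m+1}}`,
`B'' = {b''₁,…,b''_{2k+m-1}}`, the evader `ve`, and the node `v'`. -/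
inductive Node (k m : ℕ) where
  | u : Fin (3 * k) → Node k m
  | w : Fin m → Fin 3 → Node k m
  | a : Fin m → Node k m
  | b : Fin (2 * k + 2 * m) → Node k m
  | b' : Fin (k + 2 * m + 1) → Node k m
  | b'' : Fin (2 * k + m - 1) → Node k m
  | ve : Node k m
  | v' : Node k m
deriving DecidableEq, Fintype

/-- Layers: `some i` is the layer `αᵢ` (one per set `Sᵢ`), and `none` is the layer `β`. -/
abbrev Layer (m : ℕ) := Option (Fin m)

variable {k m : ℕ}

/-- Occurrences: `u j` occurs in `αᵢ` iff `j ∈ S i`; `w i j` occurs only in `αᵢ`; the evader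
and all nodes of `A` occur in every layer `αᵢ`; `v'` and all nodes of `B`, `B'`, `B''`
occur only in `β`. -/
def occ (S : Fin m → Finset (Fin (3 * k))) : Node k m → Layer m → Prop
  | .u j, some i => j ∈ S i
  | .w i _, some i' => i = i'
  | .a _, some _ => True
  | .ve, some _ => True
  | .b _, none => True
  | .b' _, none => True
  | .b'' _, none => True
  | .v', none => True
  | _, _ => False

/-- The intra-layer edges: in layer `αᵢ`, every occurring `u j` is joined to `aᵢ` and the
nodes of `A` form a clique; in layer `β`, every `bᵢ` is joined to `v'`, every `b'ᵢ` to
`bᵢ`, and every `b''ᵢ` to `b'ᵢ`. -/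
def edgeIntra (S : Fin m → Finset (Fin (3 * k))) :
    Node k m × Layer m → Node k m × Layer m → Prop
  | (.u j, some i), (.a i', some i'') => i' = i ∧ i'' = i ∧ j ∈ S i
  | (.a i₁, some t), (.a i₂, some t') => t = t' ∧ i₁ ≠ i₂
  | (.b _, none), (.v', none) => True
  | (.b' i, none), (.b j, none) => (i : ℕ) = (j : ℕ)
  | (.b'' i, none), (.b' j, none) => (i : ℕ) = (j : ℕ)
  | _, _ => False

/-- The gadget multilayer network: the intra-layer edges together with the inter-layer
edges joining every two occurrences of the same node. -/
def M (S : Fin m → Finset (Fin (3 * k))) : MLNet (Node k m) (Layer m) where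
  occ := occ S
  Edge p q := edgeIntra S p q ∨
    (p.1 = q.1 ∧ p.2 ≠ q.2 ∧ occ S p.1 p.2 ∧ occ S q.1 q.2)

/-- The contacts: all of `U ∪ W`. -/
def F : Set (Node k m) :=
  {x | (∃ j, x = Node.u j) ∨ (∃ i j, x = Node.w i j)}

/-- The Exact 3-Set Cover instance has a solution: `k` pairwise disjoint members of `S`
covering `U`. -/
def HasExactCover (k m : ℕ) (S : Fin m → Finset (Fin (3 * k))) : Prop :=
  ∃ T : Finset (Fin m), T.card = k ∧
    (∀ i ∈ T, ∀ j ∈ T, i ≠ j → Disjoint (S i) (S j)) ∧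
    (∀ x : Fin (3 * k), ∃ i ∈ T, x ∈ S i)

end XC

namespace MLNet

variable {V L : Type*} {N : MLNet V L} {v w : V}

lemma flat_adj_of_edge {a b : V × L} (hab : a ≠ b) (h : N.Edge a b) : N.flat.Adj a b :=
  (SimpleGraph.fromRel_adj _ _ _).2 ⟨hab, Or.inl h⟩

lemma mdist_le_of_walk {α β : L} {n : ℕ} (hv : N.occ v α) (hw : N.occ w β)
    (p : N.flat.Walk (v, α) (w, β)) (hp : p.length = n) : N.mdist v w ≤ n :=
  hp ▸ (iInf₂_le_of_le α β (iInf₂_le_of_le hv hw le_rfl)).trans (SimpleGraph.edist_le p)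

lemma potential_le_of_walk {G : SimpleGraph V} {f : V → ℕ∞}
    (hf : ∀ a b, G.Adj a b → f b ≤ f a + 1) {a b : V} (p : G.Walk a b) :
    f b ≤ f a + p.length := by
  induction p with
  | nil => simp
  | cons h p ih =>
    refine ih.trans ?_
    rw [SimpleGraph.Walk.length_cons, Nat.cast_add, Nat.cast_one, add_comm (p.length : ℕ∞),
      ← add_assoc]
    gcongr
    exact hf _ _ h

/-- A function on occurrences that grows by at most one along every edge and vanishes on the
occurrences of `v` bounds the distance from `v` from below. -/
lemma le_mdist_of_potential {f : V × L → ℕ∞} {e : ℕ∞}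
    (hf : ∀ a b, N.flat.Adj a b → f b ≤ f a + 1) (hv : ∀ α, f (v, α) = 0)
    (he : ∀ β, N.occ w β → e ≤ f (w, β)) : e ≤ N.mdist v w := by
  refine le_iInf₂ fun α β => le_iInf₂ fun _ hβ => le_iInf fun p => (he β hβ).trans ?_
  simpa [hv] using potential_le_of_walk hf p

lemma six_mul_closGlobal_le [Fintype V] {c : V → ℕ}
    (h : ∀ w, w ≠ v → 6 * (N.mdist v w : ℝ≥0∞)⁻¹ ≤ c w) :
    6 * N.closGlobal v ≤ (∑ w, c w : ℕ) := by
  rw [closGlobal, Finset.mul_sum, Nat.cast_sum]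
  exact (Finset.sum_le_sum fun w hw => h w (by simpa using hw)).trans
    (Finset.sum_le_sum_of_subset (Finset.filter_subset _ _))

lemma le_six_mul_closGlobal [Fintype V] {c : V → ℕ} (hc : c v = 0)
    (h : ∀ w, w ≠ v → c w ≤ 6 * (N.mdist v w : ℝ≥0∞)⁻¹) :
    (∑ w, c w : ℕ) ≤ 6 * N.closGlobal v := by
  rw [closGlobal, Finset.mul_sum,
    ← Finset.sum_filter_of_ne (p := fun w => w ≠ v) (by rintro w - hw rfl; exact hw hc),
    Nat.cast_sum]
  exact Finset.sum_le_sum fun w hw => h w (by simpa using hw)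

end MLNet

lemma ENNReal.six_mul_inv_natCast {n c : ℕ} (h : c * n = 6) : 6 * (n : ℝ≥0∞)⁻¹ = c := by
  have hn : (n : ℝ≥0∞) ≠ 0 := by
    intro h0
    rw [Nat.cast_eq_zero] at h0
    simp [h0] at h
  have h6 : (6 : ℝ≥0∞) = c * n := by exact_mod_cast h.symm
  rw [h6, mul_assoc, ENNReal.mul_inv_cancel hn (ENNReal.natCast_ne_top n), mul_one]

lemma ENat.six_mul_inv_le {d : ℕ∞} (n c : ℕ) (h : c * n = 6) (hd : n ≤ d) :
    6 * (d : ℝ≥0∞)⁻¹ ≤ c := by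
  rw [← ENNReal.six_mul_inv_natCast h]
  gcongr
  exact_mod_cast ENat.toENNReal_le.2 hd

lemma ENat.le_six_mul_inv {d : ℕ∞} (n c : ℕ) (h : c * n = 6) (hd : d ≤ n) :
    c ≤ 6 * (d : ℝ≥0∞)⁻¹ := by
  rw [← ENNReal.six_mul_inv_natCast h]
  gcongr
  exact_mod_cast ENat.toENNReal_le.2 hd

lemma ENat.six_mul_inv_le_of_top_le {d : ℕ∞} (c : ℕ) (hd : ⊤ ≤ d) :
    6 * (d : ℝ≥0∞)⁻¹ ≤ c := by
  simp [top_le_iff.1 hd]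

lemma Fin.card_filter_val_eq_le_one (n c : ℕ) :
    (Finset.univ.filter fun j : Fin n => (j : ℕ) = c).card ≤ 1 :=
  Finset.card_le_one.2 fun a ha b hb => by simp at ha hb; omega

/-- If each of the sets `S i`, `i ∈ T`, has at most `r` elements and their union has at least
`r * T.card` elements, then they are pairwise disjoint. -/
lemma Finset.disjoint_of_mul_card_le_card_biUnion {ι α : Type*} [DecidableEq α] {S : ι → Finset α}
    {T : Finset ι} {r : ℕ} (hS : ∀ i ∈ T, (S i).card ≤ r)
    (h : r * T.card ≤ (T.biUnion S).card) {i j : ι} (hi : i ∈ T) (hj : j ∈ T) (hij : i ≠ j) :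
    Disjoint (S i) (S j) := by
  have hj' : j ∈ T.erase i := Finset.mem_erase.2 ⟨hij.symm, hj⟩
  have hT : T.biUnion S = S i ∪ S j ∪ ((T.erase i).erase j).biUnion S := by
    rw [Finset.union_assoc, ← Finset.biUnion_insert, Finset.insert_erase hj',
      ← Finset.biUnion_insert, Finset.insert_erase hi]
  have hcard : T.card = ((T.erase i).erase j).card + 2 := by
    have h1 := Finset.card_erase_add_one hi
    have h2 := Finset.card_erase_add_one hj'
    omega
  have hrest : (((T.erase i).erase j).biUnion S).card ≤ ((T.erase i).erase j).card * r :=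
    Finset.card_biUnion_le_card_mul _ _ _ fun x hx =>
      hS x (Finset.mem_of_mem_erase (Finset.mem_of_mem_erase hx))
  rw [hcard, hT] at h
  have hle := h.trans (Finset.card_union_le _ _)
  have hadd := Finset.card_union_add_card_inter (S i) (S j)
  have hi' := hS i hi
  have hj'' := hS j hj
  rw [Finset.disjoint_iff_inter_eq_empty, ← Finset.card_eq_zero]
  nlinarith

namespace XC

variable {k m : ℕ} {S : Fin m → Finset (Fin (3 * k))} {A : Set (Node k m × Layer m)}

lemma sum_node {R : Type*} [AddCommMonoid R] (g : Node k m → R) :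
    ∑ x, g x = ∑ j, g (.u j) + ∑ i, ∑ j, g (.w i j) + ∑ i, g (.a i) + ∑ i, g (.b i) +
      ∑ i, g (.b' i) + ∑ i, g (.b'' i) + g .ve + g .v' := by
  let e : Fin (3 * k) ⊕ (Fin m × Fin 3) ⊕ Fin m ⊕ Fin (2 * k + 2 * m) ⊕
      Fin (k + 2 * m + 1) ⊕ Fin (2 * k + m - 1) ⊕ Unit ⊕ Unit ≃ Node k m :=
    { toFun := Sum.elim .u <| Sum.elim (fun p => .w p.1 p.2) <| Sum.elim .a <| Sum.elim .b <|
        Sum.elim .b' <| Sum.elim .b'' <| Sum.elim (fun _ => .ve) fun _ => .v'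
      invFun := fun x => match x with
        | .u j => .inl j
        | .w i j => .inr (.inl (i, j))
        | .a i => .inr (.inr (.inl i))
        | .b i => .inr (.inr (.inr (.inl i)))
        | .b' i => .inr (.inr (.inr (.inr (.inl i))))
        | .b'' i => .inr (.inr (.inr (.inr (.inr (.inl i)))))
        | .ve => .inr (.inr (.inr (.inr (.inr (.inr (.inl ()))))))
        | .v' => .inr (.inr (.inr (.inr (.inr (.inr (.inr ()))))))
      left_inv := by rintro (_ | _ | _ | _ | _ | _ | _ | _) <;> rfl
      right_inv := by rintro (_ | _ | _ | _ | _ | _ | _ | _) <;> rfl }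
  rw [← e.sum_comp]
  simp [e, Fintype.sum_sum_type, Fintype.sum_prod_type, add_assoc]

/-- Adjacent occurrences in the network with the evader's edges added satisfy every symmetric
relation that holds along each kind of edge of the construction. -/
lemma rel_of_adj (hA : Admissible (M S) .ve F A)
    {P : Node k m × Layer m → Node k m × Layer m → Prop} (hsymm : ∀ a b, P a b → P b a)
    (hinter : ∀ x l l', P (x, l) (x, l'))
    (hua : ∀ j i, j ∈ S i → P (.u j, some i) (.a i, some i))
    (haa : ∀ i i' t, P (.a i, some t) (.a i', some t))
    (hbv : ∀ i, P (.b i, none) (.v', none))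
    (hb'b : ∀ (i : Fin _) (j : Fin _), (i : ℕ) = j → P (.b' i, none) (.b j, none))
    (hb''b' : ∀ (i : Fin _) (j : Fin _), (i : ℕ) = j → P (.b'' i, none) (.b' j, none))
    (hu : ∀ j i, (.u j, some i) ∈ A → P (.ve, some i) (.u j, some i))
    (hw : ∀ i j, P (.ve, some i) (.w i j, some i))
    {a b : Node k m × Layer m} (hab : ((M S).addEdges .ve A).flat.Adj a b) : P a b := by
  have hnew : ∀ p ∈ A, P (.ve, p.2) (p.1, p.2) := by
    rintro ⟨x, l⟩ hp
    obtain ⟨hF, hve, hx⟩ := hA _ hp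
    cases l with
    | none => exact hve.elim
    | some l =>
      obtain ⟨j, rfl⟩ | ⟨i, j, rfl⟩ : (∃ j, x = Node.u j) ∨ (∃ i j, x = Node.w i j) := hF
      · exact hu _ _ hp
      · obtain rfl : i = l := hx
        exact hw _ _
  have hedge : ∀ a b, ((M S).addEdges .ve A).Edge a b → P a b := by
    rintro ⟨x, l⟩ ⟨y, l'⟩ ((h | ⟨h, -⟩) | ⟨p, hp, h | h⟩)
    · revert h
      generalize ((x, l) : Node k m × Layer m) = a
      generalize ((y, l') : Node k m × Layer m) = b
      unfold edgeIntra
      split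
      · rintro ⟨rfl, rfl, h⟩
        exact hua _ _ h
      · rintro ⟨rfl, -⟩
        exact haa _ _ _
      · exact fun _ => hbv _
      · exact hb'b _ _
      · exact hb''b' _ _
      · exact False.elim
    · obtain rfl : x = y := h
      exact hinter _ _ _
    · rw [h.1, h.2]
      exact hnew p hp
    · rw [h.1, h.2]
      exact hsymm _ _ (hnew p hp)
  obtain ⟨-, h | h⟩ := (SimpleGraph.fromRel_adj _ _ _).1 hab
  · exact hedge _ _ h
  · exact hsymm _ _ (hedge _ _ h)

/-- Whether a node lies in the layers `αᵢ` (rather than in `β`). -/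
def inAlpha : Node k m → Bool
  | .u _ | .w _ _ | .a _ | .ve => true
  | _ => false

/-- The set layers in which the evader is joined to some element of the universe. -/
noncomputable def usedLayers (A : Set (Node k m × Layer m)) : Finset (Fin m) :=
  Finset.univ.filter fun i => ∃ j, (Node.u j, some i) ∈ A

lemma mem_usedLayers {i : Fin m} : i ∈ usedLayers A ↔ ∃ j, (Node.u j, some i) ∈ A := by
  simp [usedLayers]

/-- A node `z` whose neighbours all lie in `N` has at most `N.card` nodes at distance one and
all the other nodes of its component at distance at least two. -/
lemma six_mul_closGlobal_le_of_neighbors (hA : Admissible (M S) .ve F A) {z : Node k m}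
    (N : Finset (Node k m))
    (hadj : ∀ a b, ((M S).addEdges .ve A).flat.Adj a b → a.1 = z → b.1 = z ∨ b.1 ∈ N) :
    6 * ((M S).addEdges .ve A).closGlobal z ≤
      ((∑ x : Node k m, if inAlpha x = inAlpha z then 3 else 0) + 3 * N.card : ℕ) := by
  let f : Node k m × Layer m → ℕ∞ := fun p =>
    if p.1 = z then 0 else if inAlpha p.1 = inAlpha z then (if p.1 ∈ N then 1 else 2) else ⊤
  have hside : ∀ a b, ((M S).addEdges .ve A).flat.Adj a b → inAlpha a.1 = inAlpha b.1 := by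
    intro a b hab
    refine rel_of_adj hA (P := fun a b => inAlpha a.1 = inAlpha b.1)
      ?_ ?_ ?_ ?_ ?_ ?_ ?_ ?_ ?_ hab <;> intros <;> first | rfl | (symm; assumption)
  have hf : ∀ a b, ((M S).addEdges .ve A).flat.Adj a b → f b ≤ f a + 1 := by
    intro a b hab
    have h1 := hadj a b hab
    have h2 := hside a b hab
    have h4 : (1 : ℕ∞) + 1 = 2 := by norm_num
    simp only [f, ← h2]
    split_ifs <;> simp_all
  have hsum : ∑ x : Node k m, ((if inAlpha x = inAlpha z then 3 else 0) + if x ∈ N then 3 else 0)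
      = (∑ x : Node k m, if inAlpha x = inAlpha z then 3 else 0) + 3 * N.card := by
    rw [Finset.sum_add_distrib]
    simp [mul_comm]
  rw [← hsum]
  refine MLNet.six_mul_closGlobal_le fun x hx => ?_
  have hle : f (x, none) ≤ ((M S).addEdges .ve A).mdist z x :=
    MLNet.le_mdist_of_potential hf (by simp [f]) fun β _ => le_rfl
  simp only [f, if_neg hx] at hle
  split_ifs at hle ⊢ with h1 h2
  · exact ENat.six_mul_inv_le 1 6 rfl hle
  · exact ENat.six_mul_inv_le 2 3 rfl hle
  · exact ENat.six_mul_inv_le_of_top_le _ hle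
  · exact ENat.six_mul_inv_le_of_top_le _ hle

lemma sum_inAlpha (z : Node k m) (hk : 1 ≤ k) :
    (∑ x : Node k m, if inAlpha x = inAlpha z then 3 else 0) =
      if inAlpha z then 9 * k + 12 * m + 3 else 15 * k + 15 * m + 3 := by
  rw [sum_node]
  cases hz : inAlpha z <;> simp [inAlpha] <;> omega

lemma six_mul_closGlobal_le_of_ne (hA : Admissible (M S) .ve F A) (hk : 1 ≤ k) (hkm : k ≤ m)
    (hS : ∀ i, (S i).card = 3) {z : Node k m} (hve : z ≠ .ve) (hv' : z ≠ .v') :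
    6 * ((M S).addEdges .ve A).closGlobal z ≤ (18 * k + 20 * m + 1 : ℕ) := by
  suffices ∃ N : Finset (Node k m), N.card ≤ (if inAlpha z then m + 3 else 2) ∧
      ∀ a b, ((M S).addEdges .ve A).flat.Adj a b →
        (a.1 = z → b.1 = z ∨ b.1 ∈ N) ∧ (b.1 = z → a.1 = z ∨ a.1 ∈ N) by
    obtain ⟨N, hN, hadj⟩ := this
    refine (six_mul_closGlobal_le_of_neighbors hA N fun a b h => (hadj a b h).1).trans ?_
    rw [sum_inAlpha z hk, Nat.cast_le]
    split_ifs at hN ⊢ <;> omega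
  cases z with
  | ve => exact absurd rfl hve
  | v' => exact absurd rfl hv'
  | u j =>
    refine ⟨insert .ve (Finset.univ.image .a), ?_, fun a b hab => ?_⟩
    · refine (Finset.card_insert_le _ _).trans ?_
      have := Finset.card_image_le (s := (Finset.univ : Finset (Fin m))) (f := Node.a (k := k))
      simp [inAlpha] at this ⊢
      omega
    · refine rel_of_adj hA (P := fun a b => (a.1 = Node.u j → b.1 = Node.u j ∨ b.1 ∈ _) ∧
        (b.1 = Node.u j → a.1 = Node.u j ∨ a.1 ∈ _)) (fun _ _ h => ⟨h.2, h.1⟩)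
        ?_ ?_ ?_ ?_ ?_ ?_ ?_ ?_ hab <;> simp
  | w i j =>
    refine ⟨{.ve}, by simp [inAlpha], fun a b hab => ?_⟩
    refine rel_of_adj hA (P := fun a b => (a.1 = Node.w i j → b.1 = Node.w i j ∨ b.1 ∈ _) ∧
        (b.1 = Node.w i j → a.1 = Node.w i j ∨ a.1 ∈ _)) (fun _ _ h => ⟨h.2, h.1⟩)
        ?_ ?_ ?_ ?_ ?_ ?_ ?_ ?_ hab <;> simp
  | a i =>
    refine ⟨Finset.univ.image .a ∪ (S i).image .u, ?_, fun a b hab => ?_⟩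
    · refine (Finset.card_union_le _ _).trans ?_
      have h1 := Finset.card_image_le (s := (Finset.univ : Finset (Fin m))) (f := Node.a (k := k))
      have h2 := Finset.card_image_le (s := S i) (f := Node.u (m := m))
      rw [hS] at h2
      simp [inAlpha] at h1 h2 ⊢
      omega
    · refine rel_of_adj hA (P := fun a b => (a.1 = Node.a i → b.1 = Node.a i ∨ b.1 ∈ _) ∧
        (b.1 = Node.a i → a.1 = Node.a i ∨ a.1 ∈ _)) (fun _ _ h => ⟨h.2, h.1⟩)
        ?_ ?_ ?_ ?_ ?_ ?_ ?_ ?_ hab <;> simp +contextual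
      rintro j i' h rfl
      exact h
  | b i =>
    refine ⟨insert .v' ((Finset.univ.filter fun j : Fin _ => (j : ℕ) = i).image .b'), ?_,
      fun a b hab => ?_⟩
    · refine (Finset.card_insert_le _ _).trans ?_
      have := (Finset.card_image_le (f := Node.b' (k := k))).trans
        (Fin.card_filter_val_eq_le_one (k + 2 * m + 1) i)
      simpa [inAlpha] using this
    · refine rel_of_adj hA (P := fun a b => (a.1 = Node.b i → b.1 = Node.b i ∨ b.1 ∈ _) ∧
        (b.1 = Node.b i → a.1 = Node.b i ∨ a.1 ∈ _)) (fun _ _ h => ⟨h.2, h.1⟩)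
        ?_ ?_ ?_ ?_ ?_ ?_ ?_ ?_ hab <;> simp +contextual
  | b' i =>
    refine ⟨(Finset.univ.filter fun j : Fin _ => (j : ℕ) = i).image .b ∪
      (Finset.univ.filter fun j : Fin _ => (j : ℕ) = i).image .b'', ?_, fun a b hab => ?_⟩
    · refine (Finset.card_union_le _ _).trans ?_
      have h1 := (Finset.card_image_le (f := Node.b (k := k))).trans
        (Fin.card_filter_val_eq_le_one (2 * k + 2 * m) i)
      have h2 := (Finset.card_image_le (f := Node.b'' (k := k))).trans
        (Fin.card_filter_val_eq_le_one (2 * k + m - 1) i)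
      simpa [inAlpha] using Nat.add_le_add h1 h2
    · refine rel_of_adj hA (P := fun a b => (a.1 = Node.b' i → b.1 = Node.b' i ∨ b.1 ∈ _) ∧
        (b.1 = Node.b' i → a.1 = Node.b' i ∨ a.1 ∈ _)) (fun _ _ h => ⟨h.2, h.1⟩)
        ?_ ?_ ?_ ?_ ?_ ?_ ?_ ?_ hab <;> simp +contextual
      rintro i' j h rfl
      exact h.symm
  | b'' i =>
    refine ⟨(Finset.univ.filter fun j : Fin _ => (j : ℕ) = i).image .b', ?_, fun a b hab => ?_⟩
    · have := (Finset.card_image_le (f := Node.b' (k := k))).trans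
        (Fin.card_filter_val_eq_le_one (k + 2 * m + 1) i)
      exact this.trans (by simp [inAlpha])
    · refine rel_of_adj hA (P := fun a b => (a.1 = Node.b'' i → b.1 = Node.b'' i ∨ b.1 ∈ _) ∧
        (b.1 = Node.b'' i → a.1 = Node.b'' i ∨ a.1 ∈ _)) (fun _ _ h => ⟨h.2, h.1⟩)
        ?_ ?_ ?_ ?_ ?_ ?_ ?_ ?_ hab <;> simp +contextual
      rintro i' j h rfl
      exact h.symm

/-- Distances from `v'` to the nodes of `β`. -/
def betaDist : Node k m → ℕ∞
  | .v' => 0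
  | .b _ => 1
  | .b' _ => 2
  | .b'' _ => 3
  | _ => ⊤

/-- Six times the contribution of each node to the closeness centrality of `v'`. -/
def betaWeight : Node k m → ℕ
  | .b _ => 6
  | .b' _ => 3
  | .b'' _ => 2
  | _ => 0

lemma sum_betaWeight (hk : 1 ≤ k) :
    ∑ x : Node k m, betaWeight x = 19 * k + 20 * m + 1 := by
  rw [sum_node]
  simp [betaWeight]
  omega

lemma six_mul_closGlobal_v'_le (hA : Admissible (M S) .ve F A) (hk : 1 ≤ k) :
    6 * ((M S).addEdges .ve A).closGlobal .v' ≤ (19 * k + 20 * m + 1 : ℕ) := by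
  have hf : ∀ a b, ((M S).addEdges .ve A).flat.Adj a b →
      betaDist b.1 ≤ betaDist a.1 + 1 := by
    intro a b hab
    refine (rel_of_adj hA (P := fun a b => betaDist b.1 ≤ betaDist a.1 + 1 ∧
      betaDist a.1 ≤ betaDist b.1 + 1) (fun _ _ h => ⟨h.2, h.1⟩)
      ?_ ?_ ?_ ?_ ?_ ?_ ?_ ?_ hab).1 <;> intros <;> simp [betaDist] <;> norm_num
  rw [← sum_betaWeight hk]
  refine MLNet.six_mul_closGlobal_le fun x hx => ?_
  have hle : betaDist x ≤ ((M S).addEdges .ve A).mdist .v' x :=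
    MLNet.le_mdist_of_potential (f := fun p => betaDist p.1) hf (fun _ => rfl) fun _ _ => le_rfl
  cases x with
  | v' => exact absurd rfl hx
  | b i => exact ENat.six_mul_inv_le 1 6 rfl hle
  | b' i => exact ENat.six_mul_inv_le 2 3 rfl hle
  | b'' i => exact ENat.six_mul_inv_le 3 2 rfl hle
  | _ => exact ENat.six_mul_inv_le_of_top_le _ hle

lemma le_six_mul_closGlobal_v' (hk : 1 ≤ k) (hkm : k ≤ m) :
    (19 * k + 20 * m + 1 : ℕ) ≤ 6 * ((M S).addEdges .ve A).closGlobal .v' := by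
  have hb : ∀ i, ((M S).addEdges .ve A).flat.Adj (.v', none) (.b i, none) := fun i =>
    (MLNet.flat_adj_of_edge (by simp) (Or.inl (Or.inl trivial))).symm
  have hb' : ∀ (i : Fin (2 * k + 2 * m)) (j : Fin (k + 2 * m + 1)), (j : ℕ) = i →
      ((M S).addEdges .ve A).flat.Adj (.b i, none) (.b' j, none) := fun i j h =>
    (MLNet.flat_adj_of_edge (by simp) (Or.inl (Or.inl h))).symm
  have hb'' : ∀ (i : Fin (k + 2 * m + 1)) (j : Fin (2 * k + m - 1)), (j : ℕ) = i →
      ((M S).addEdges .ve A).flat.Adj (.b' i, none) (.b'' j, none) := fun i j h =>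
    (MLNet.flat_adj_of_edge (by simp) (Or.inl (Or.inl h))).symm
  rw [← sum_betaWeight hk]
  refine MLNet.le_six_mul_closGlobal rfl fun x hx => ?_
  cases x with
  | b i =>
    exact ENat.le_six_mul_inv 1 6 rfl (MLNet.mdist_le_of_walk (α := none) (β := none)
      trivial trivial (.cons (hb i) .nil) rfl)
  | b' i =>
    exact ENat.le_six_mul_inv 2 3 rfl (MLNet.mdist_le_of_walk (α := none) (β := none)
      trivial trivial (.cons (hb _) (.cons (hb' ⟨i, by omega⟩ i rfl) .nil)) rfl)
  | b'' i =>
    exact ENat.le_six_mul_inv 3 2 rfl (MLNet.mdist_le_of_walk (α := none) (β := none)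
      trivial trivial (.cons (hb _) (.cons (hb' ⟨i, by omega⟩ ⟨i, by omega⟩ rfl)
        (.cons (hb'' _ i rfl) .nil))) rfl)
  | _ => simp [betaWeight]

/-- A potential that bounds distances from the evader from below; `T` contains the layers in
which the evader is joined to some element of the universe. -/
noncomputable def evaderPotential (T : Finset (Fin m)) : Node k m × Layer m → ℕ∞
  | (.ve, _) => 0
  | (.w _ _, _) => 1
  | (.u _, some i) => if i ∈ T then 1 else 2
  | (.u _, none) => 1
  | (.a i, _) => if i ∈ T then 2 else 3
  | _ => ⊤

/-- Six times the contribution of each node to the closeness centrality of the evader. -/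
noncomputable def evaderWeight (T : Finset (Fin m)) : Node k m → ℕ
  | .u _ => 6
  | .w _ _ => 6
  | .a i => if i ∈ T then 3 else 2
  | _ => 0

lemma sum_evaderWeight (T : Finset (Fin m)) :
    ∑ x : Node k m, evaderWeight T x = 18 * k + 20 * m + T.card := by
  have h : ∑ i, (if i ∈ T then 3 else 2) = 2 * m + T.card := by
    have : ∀ i, (if i ∈ T then 3 else 2) = 2 + if i ∈ T then 1 else 0 := by
      intro i; split_ifs <;> rfl
    simp only [this, Finset.sum_add_distrib]
    simp [mul_comm]
  rw [sum_node]
  simp [evaderWeight, h]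
  omega

lemma six_mul_closGlobal_ve_le (hA : Admissible (M S) .ve F A) :
    6 * ((M S).addEdges .ve A).closGlobal .ve ≤
      (18 * k + 20 * m + (usedLayers A).card : ℕ) := by
  have hf : ∀ a b, ((M S).addEdges .ve A).flat.Adj a b →
      evaderPotential (usedLayers A) b ≤ evaderPotential (usedLayers A) a + 1 := by
    intro a b hab
    refine (rel_of_adj hA (P := fun a b =>
      evaderPotential (usedLayers A) b ≤ evaderPotential (usedLayers A) a + 1 ∧
      evaderPotential (usedLayers A) a ≤ evaderPotential (usedLayers A) b + 1)
      (fun _ _ h => ⟨h.2, h.1⟩) ?_ ?_ ?_ ?_ ?_ ?_ ?_ ?_ hab).1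
    · rintro (_ | _ | _ | _ | _ | _ | _ | _) (_ | _) (_ | _) <;> simp only [evaderPotential] <;>
        (try split_ifs) <;> norm_num
    · intro j i _
      simp only [evaderPotential]
      split_ifs <;> norm_num
    · intro i i' t
      simp only [evaderPotential]
      split_ifs <;> norm_num
    · simp [evaderPotential]
    · simp [evaderPotential]
    · simp [evaderPotential]
    · intro j i h
      simp [evaderPotential, mem_usedLayers.2 ⟨j, h⟩]
    · simp [evaderPotential]
  have hle {x : Node k m} {e : ℕ∞} (he : ∀ l, e ≤ evaderPotential (usedLayers A) (x, l)) :
      e ≤ ((M S).addEdges .ve A).mdist .ve x :=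
    MLNet.le_mdist_of_potential hf (fun _ => rfl) fun l _ => he l
  rw [← sum_evaderWeight]
  refine MLNet.six_mul_closGlobal_le fun x hx => ?_
  cases x with
  | ve => exact absurd rfl hx
  | u j =>
    refine ENat.six_mul_inv_le 1 6 rfl (hle ?_)
    rintro (_ | l) <;> simp only [evaderPotential] <;> (try split_ifs) <;> norm_num
  | w i j => exact ENat.six_mul_inv_le 1 6 rfl (hle fun _ => le_rfl)
  | a i =>
    have : (if i ∈ usedLayers A then (2 : ℕ∞) else 3) ≤
        ((M S).addEdges .ve A).mdist .ve (.a i) := hle fun _ => le_rfl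
    simp only [evaderWeight]
    split_ifs at this ⊢
    · exact ENat.six_mul_inv_le 2 3 rfl this
    · exact ENat.six_mul_inv_le 3 2 rfl this
  | _ => exact ENat.six_mul_inv_le_of_top_le _ (hle fun _ => le_rfl)

lemma le_six_mul_closGlobal_ve (hA : Admissible (M S) .ve F A) (hF : ConnectsAll F A)
    (hk : 1 ≤ k) :
    (18 * k + 20 * m + (usedLayers A).card : ℕ) ≤
      6 * ((M S).addEdges .ve A).closGlobal .ve := by
  have hnew : ∀ x ∈ F, ∀ l, (x, l) ∈ A →
      ((M S).addEdges .ve A).flat.Adj (.ve, l) (x, l) := by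
    intro x hx l h
    refine MLNet.flat_adj_of_edge ?_ (Or.inr ⟨_, h, Or.inl ⟨rfl, rfl⟩⟩)
    intro h'
    obtain ⟨rfl, -⟩ := Prod.mk.inj h'
    simp [F] at hx
  have hcontact : ∀ x ∈ F, ((M S).addEdges .ve A).mdist .ve x ≤ (1 : ℕ) := by
    intro x hx
    obtain ⟨l, hl⟩ := hF x hx
    exact MLNet.mdist_le_of_walk (α := l) (β := l) (hA _ hl).2.1 (hA _ hl).2.2
      (.cons (hnew x hx l hl) .nil) rfl
  have huF : ∀ j, Node.u j ∈ (F : Set (Node k m)) := fun j => Or.inl ⟨j, rfl⟩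
  have hua : ∀ j i, (Node.u j, some i) ∈ A →
      ((M S).addEdges .ve A).flat.Adj (.u j, some i) (.a i, some i) := fun j i h =>
    MLNet.flat_adj_of_edge (by simp) (Or.inl (Or.inl ⟨rfl, rfl, (hA _ h).2.2⟩))
  have haa : ∀ i i' t, i ≠ i' →
      ((M S).addEdges .ve A).flat.Adj (.a i, some t) (.a i', some t) := fun i i' t h =>
    MLNet.flat_adj_of_edge (by simpa using h) (Or.inl (Or.inl ⟨rfl, h⟩))
  rw [← sum_evaderWeight]
  refine MLNet.le_six_mul_closGlobal rfl fun x hx => ?_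
  cases x with
  | u j => exact ENat.le_six_mul_inv 1 6 rfl (hcontact _ (huF j))
  | w i j => exact ENat.le_six_mul_inv 1 6 rfl (hcontact _ (Or.inr ⟨i, j, rfl⟩))
  | a i =>
    simp only [evaderWeight]
    split_ifs with hi
    · obtain ⟨j, hj⟩ := mem_usedLayers.1 hi
      exact ENat.le_six_mul_inv 2 3 rfl (MLNet.mdist_le_of_walk (α := some i) (β := some i)
        trivial trivial (.cons (hnew _ (huF j) _ hj) (.cons (hua j i hj) .nil)) rfl)
    · obtain ⟨l, hl⟩ := hF _ (huF ⟨0, by omega⟩)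
      cases l with
      | none => exact (hA _ hl).2.1.elim
      | some t =>
        have hti : t ≠ i := by
          rintro rfl
          exact hi (mem_usedLayers.2 ⟨_, hl⟩)
        exact ENat.le_six_mul_inv 3 2 rfl (MLNet.mdist_le_of_walk (α := some t) (β := some t)
          trivial trivial (.cons (hnew _ (huF _) _ hl)
            (.cons (hua _ t hl) (.cons (haa t i t hti) .nil))) rfl)
  | _ => simp [evaderWeight]

/-- The edges joining the evader to all `W`-nodes, and to the elements of `S i` in layer `αᵢ`
for each `i ∈ T`. -/
def coverEdges (S : Fin m → Finset (Fin (3 * k))) (T : Finset (Fin m)) :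
    Set (Node k m × Layer m) :=
  {p | (∃ i j, p = (.w i j, some i)) ∨ ∃ i j, i ∈ T ∧ j ∈ S i ∧ p = (.u j, some i)}

lemma admissible_coverEdges (T : Finset (Fin m)) :
    Admissible (M S) .ve F (coverEdges S T) := by
  rintro p (⟨i, j, rfl⟩ | ⟨i, j, -, hj, rfl⟩)
  · exact ⟨Or.inr ⟨i, j, rfl⟩, trivial, rfl⟩
  · exact ⟨Or.inl ⟨j, rfl⟩, trivial, hj⟩

lemma connectsAll_coverEdges {T : Finset (Fin m)} (hT : ∀ x, ∃ i ∈ T, x ∈ S i) :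
    ConnectsAll F (coverEdges S T) := by
  rintro x (⟨j, rfl⟩ | ⟨i, j, rfl⟩)
  · obtain ⟨i, hi, hj⟩ := hT j
    exact ⟨some i, Or.inr ⟨i, j, hi, hj, rfl⟩⟩
  · exact ⟨some i, Or.inl ⟨i, j, rfl⟩⟩

lemma usedLayers_coverEdges_subset (T : Finset (Fin m)) :
    usedLayers (coverEdges S T) ⊆ T := by
  intro i hi
  obtain ⟨j, ⟨_, _, h⟩ | ⟨i', j', hi', -, h⟩⟩ := mem_usedLayers.1 hi
  · simp at h
  · simp only [Prod.mk.injEq, Option.some.injEq] at h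
    exact h.2 ▸ hi'

lemma usedLayers_covers (hA : Admissible (M S) .ve F A) (hF : ConnectsAll F A)
    (x : Fin (3 * k)) : ∃ i ∈ usedLayers A, x ∈ S i := by
  obtain ⟨l, hl⟩ := hF (.u x) (Or.inl ⟨x, rfl⟩)
  cases l with
  | none => exact (hA _ hl).2.1.elim
  | some i => exact ⟨i, mem_usedLayers.2 ⟨x, hl⟩, (hA _ hl).2.2⟩

/-- A cover by at most `k` sets of size three is an exact cover. -/
lemma hasExactCover_of_card_le (hS : ∀ i, (S i).card = 3) {T : Finset (Fin m)}
    (hT : T.card ≤ k) (hcov : ∀ x, ∃ i ∈ T, x ∈ S i) : HasExactCover k m S := by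
  have huniv : (T.biUnion S).card = 3 * k := by
    rw [(Finset.eq_univ_iff_forall.2 fun x => Finset.mem_biUnion.2 (hcov x) :
      T.biUnion S = Finset.univ), Finset.card_univ, Fintype.card_fin]
  have hle : (T.biUnion S).card ≤ T.card * 3 :=
    Finset.card_biUnion_le_card_mul _ _ _ fun i _ => (hS i).le
  exact ⟨T, by omega, fun i hi j hj hij => Finset.disjoint_of_mul_card_le_card_biUnion
    (r := 3) (fun i _ => (hS i).le) (by omega) hi hj hij, hcov⟩

end XC

/-- **Theorem: Multilayer Global Hiding is NP-complete for closeness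
centrality.** The Exact 3-Set Cover instance `(U, S)` has a solution iff the constructed
instance of Multilayer Global Hiding with closeness centrality and safety margin `d = 1`
has a solution. -/
theorem global_closeness_hiding_reduction (k m : ℕ) (hk : 1 ≤ k) (hkm : k ≤ m)
    (S : Fin m → Finset (Fin (3 * k))) (hS : ∀ i, (S i).card = 3) :
    XC.HasExactCover k m S
    ↔ (∃ A : Set (XC.Node k m × XC.Layer m),
        Admissible (XC.M S) XC.Node.ve XC.F A ∧
        ConnectsAll XC.F A ∧
        ∃ z : XC.Node k m,
          ((XC.M S).addEdges XC.Node.ve A).closGlobal XC.Node.ve <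
          ((XC.M S).addEdges XC.Node.ve A).closGlobal z) := by
  constructor
  · rintro ⟨T, hTk, -, hcov⟩
    have hA := XC.admissible_coverEdges (S := S) T
    refine ⟨XC.coverEdges S T, hA, XC.connectsAll_coverEdges hcov, .v', ?_⟩
    have hT := Finset.card_le_card (XC.usedLayers_coverEdges_subset (S := S) T)
    refine lt_of_mul_lt_mul_left' (a := (6 : ℝ≥0∞)) ?_
    refine (XC.six_mul_closGlobal_ve_le hA).trans_lt
      (lt_of_lt_of_le ?_ (XC.le_six_mul_closGlobal_v' hk hkm))
    exact_mod_cast (by omega)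
  · rintro ⟨A, hA, hF, z, hz⟩
    have hcov := XC.usedLayers_covers hA hF
    have hpos : 0 < (XC.usedLayers A).card := by
      obtain ⟨i, hi, -⟩ := hcov ⟨0, by omega⟩
      exact Finset.card_pos.2 ⟨i, hi⟩
    have hve := XC.le_six_mul_closGlobal_ve hA hF hk
    have hlt {n : ℕ} (hn : 6 * ((XC.M S).addEdges .ve A).closGlobal z ≤ n) :
        18 * k + 20 * m + (XC.usedLayers A).card < n := by
      have h6 := (ENNReal.mul_lt_mul_iff_right (a := 6) (by norm_num) (by norm_num)).2 hz
      exact_mod_cast (hve.trans_lt h6).trans_le hn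
    by_cases hzve : z = .ve
    · exact absurd hz (by simp [hzve])
    by_cases hzv' : z = .v'
    · have := hlt (hzv' ▸ XC.six_mul_closGlobal_v'_le hA hk)
      exact XC.hasExactCover_of_card_le hS (by omega) hcov
    · have := hlt (XC.six_mul_closGlobal_le_of_ne hA hk hkm hS hzve hzv')
      omega
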